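/- Let (S(t))_{t≥0} satisfy Assumption S. For every r, T ≥ 0 and ε > 0 there exists λ₀ ∈ (0,1] such that, for all t ∈ [0,T], all f ∈ B_{C_κ}(r) ∩ L^S_+ and all λ ∈ (0,λ₀], the pointwise inequality S(t)f − f ≤ λ·∫₀ᵗ S(s)( (1/λ)·A_Γ⁺f + f ) ds + ε·t/κ holds, where the integral is taken pointwise: (∫₀ᵗ S(s)g ds)(x) := ∫₀ᵗ (S(s)g)(x) ds. -/

import Mathlib

open Filter MeasureTheory Topology
open scoped ENNReal Topology

noncomputable section

def ecoe {X : Type*} (f : X → ℝ) : X → EReal := fun x => (f x : EReal)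

variable {X : Type*} [MetricSpace X]

/-- membership in `C_κ` -/
def MemCk (κ : X → ℝ) (f : X → ℝ) : Prop :=
  Continuous f ∧ ∃ r : ℝ, ∀ x, |f x| * κ x ≤ r

/-- `‖f‖_κ ≤ r` -/
def CkBound (κ : X → ℝ) (r : ℝ) (f : X → ℝ) : Prop := ∀ x, |f x| * κ x ≤ r

/-- extended `κ`-norm of an `EReal`-valued function -/
def eknorm (κ : X → ℝ) (f : X → EReal) : ℝ≥0∞ :=
  ⨆ x, (f x).abs * ENNReal.ofReal (κ x)

/-- positive part of an `EReal`-valued function -/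
def epos {X : Type*} (f : X → EReal) : X → EReal := fun x => max (f x) 0

/-- membership in `U_κ` -/
def MemUk (κ : X → ℝ) (f : X → EReal) : Prop :=
  UpperSemicontinuous f ∧ (∀ x, f x < ⊤) ∧
    ∃ r : ℝ, ∀ x, max (f x) 0 * (κ x : EReal) ≤ (r : EReal)

/-- `Γ`-limsup of a sequence of functions -/
def gammaLimsup (f : ℕ → X → EReal) (x : X) : EReal :=
  ⨆ (u : ℕ → X) (_ : Tendsto u atTop (𝓝 x)),
    Filter.limsup (fun n => f n (u n)) atTop

/-- `g = Γ-lim f_n` -/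
def IsGammaLim (f : ℕ → X → EReal) (g : X → EReal) : Prop :=
  ∀ x : X,
    (∀ u : ℕ → X, Tendsto u atTop (𝓝 x) →
      Filter.limsup (fun n => f n (u n)) atTop ≤ g x) ∧
    (∃ u : ℕ → X, Tendsto u atTop (𝓝 x) ∧
      Tendsto (fun n => f n (u n)) atTop (𝓝 (g x)))

/-- `Γ`-limsup as `h ↓ 0` -/
def gammaLimsupZero (F : ℝ → X → EReal) (x : X) : EReal :=
  ⨆ (h : ℕ → ℝ) (_ : ∀ n, 0 < h n) (_ : Tendsto h atTop (𝓝 (0:ℝ))),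
    gammaLimsup (fun n => F (h n)) x

/-- `Γ`-limsup as `s → t`, `s ≥ 0` -/
def gammaLimsupAt (F : ℝ → X → EReal) (t : ℝ) (x : X) : EReal :=
  ⨆ (s : ℕ → ℝ) (_ : ∀ n, 0 ≤ s n) (_ : Tendsto s atTop (𝓝 t)),
    gammaLimsup (fun n => F (s n)) x

/-- Assumption S on a family of operators on `U_κ` -/
structure AssumptionS (κ : X → ℝ) (S : ℝ → (X → EReal) → (X → EReal)) : Prop where
  monotone : ∀ t, 0 ≤ t → ∀ f g, MemUk κ f → MemUk κ g →
    (∀ x, f x ≤ g x) → ∀ x, S t f x ≤ S t g x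
  convex : ∀ t, 0 ≤ t → ∀ f g, MemUk κ f → MemUk κ g → ∀ lam : ℝ, 0 ≤ lam → lam ≤ 1 →
    ∀ x, S t (fun y => (lam : EReal) * f y + ((1 - lam : ℝ) : EReal) * g y) x
      ≤ (lam : EReal) * S t f x + ((1 - lam : ℝ) : EReal) * S t g x
  zero : ∀ t, 0 ≤ t → ∀ x, S t (fun _ => (0 : EReal)) x = 0
  maps : ∀ t, 0 ≤ t → ∀ f, MemUk κ f → MemUk κ (S t f)
  contAbove : ∀ t, 0 ≤ t → ∀ (f : ℕ → X → EReal) (g : X → EReal),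
    (∀ n, MemUk κ (f n)) → MemUk κ g →
    (∀ x, Antitone fun n => f n x) → (∀ x, (⨅ n, f n x) = g x) →
    ∀ x, (⨅ n, S t (f n) x) = S t g x
  gammaUsc : ∀ t, 0 ≤ t → ∀ f, MemUk κ f →
    ∀ x, gammaLimsupAt (fun s => S s f) t x ≤ S t f x
  idZero : ∀ f, MemUk κ f → S 0 f = f
  bounded : ∀ r t : ℝ, 0 ≤ r → 0 ≤ t → ∃ C : ℝ≥0∞, C ≠ ⊤ ∧
    ∀ s, 0 ≤ s → s ≤ t → ∀ f : X → ℝ, MemCk κ f → CkBound κ r f →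
      eknorm κ (S s (ecoe f)) ≤ C

/-- an `EReal`-valued function which belongs to `C_κ` -/
def IsCk (κ : X → ℝ) (F : X → EReal) : Prop :=
  ∃ g : X → ℝ, MemCk κ g ∧ ∀ x, F x = (g x : EReal)

/-- the upper Lipschitz set `L^S_+` -/
def UpperLip (κ : X → ℝ) (S : ℝ → (X → EReal) → (X → EReal)) (f : X → ℝ) : Prop :=
  MemCk κ f ∧
  (∀ t, 0 ≤ t → IsCk κ (S t (ecoe f))) ∧
  (∀ s t, 0 ≤ s → 0 ≤ t → S (s + t) (ecoe f) = S s (S t (ecoe f))) ∧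
  ∃ h₀ > (0:ℝ), ∃ c ≥ (0:ℝ), ∀ h, 0 ≤ h → h ≤ h₀ → ∀ x,
    max (S h (ecoe f) x - (f x : EReal)) 0 * (κ x : EReal) ≤ ((c * h : ℝ) : EReal)

/-- the (two-sided) Lipschitz set `L^S` -/
def LipSet (κ : X → ℝ) (S : ℝ → (X → EReal) → (X → EReal)) (f : X → ℝ) : Prop :=
  MemCk κ f ∧
  (∀ t, 0 ≤ t → IsCk κ (S t (ecoe f))) ∧
  (∀ s t, 0 ≤ s → 0 ≤ t → S (s + t) (ecoe f) = S s (S t (ecoe f))) ∧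
  ∃ h₀ > (0:ℝ), ∃ c ≥ (0:ℝ), ∀ h, 0 ≤ h → h ≤ h₀ → ∀ x,
    (S h (ecoe f) x - (f x : EReal)).abs * ENNReal.ofReal (κ x) ≤ ENNReal.ofReal (c * h)

/-- difference quotient `(S(h)f - f)/h` -/
def diffQuot (S : ℝ → (X → EReal) → (X → EReal)) (f : X → ℝ) (h : ℝ) : X → EReal :=
  fun x => ((h⁻¹ : ℝ) : EReal) * (S h (ecoe f) x - (f x : EReal))

/-- the upper `Γ`-generator `A_Γ⁺` -/
def uppGen (S : ℝ → (X → EReal) → (X → EReal)) (f : X → ℝ) : X → EReal :=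
  fun x => gammaLimsupZero (fun h => diffQuot S f h) x

/-- `g = A_Γ f`, i.e. the `Γ`-limit of the difference quotients exists and equals `g` -/
def IsGammaDeriv (S : ℝ → (X → EReal) → (X → EReal)) (f : X → ℝ) (g : X → EReal) : Prop :=
  ∀ h : ℕ → ℝ, (∀ n, 0 < h n) → Tendsto h atTop (𝓝 (0:ℝ)) →
    IsGammaLim (fun n => diffQuot S f (h n)) g

/-- `g = Af` in the mixed topology -/
def MixedDeriv (κ : X → ℝ) (S : ℝ → (X → EReal) → (X → EReal)) (f : X → ℝ) (g : X → ℝ) : Prop :=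
  (∃ h₀ > (0:ℝ), ∃ r : ℝ, ∀ h, 0 < h → h ≤ h₀ → ∀ x,
      |h⁻¹ * ((S h (ecoe f) x).toReal - f x)| * κ x ≤ r) ∧
  ∀ K : Set X, IsCompact K → ∀ ε > (0:ℝ), ∃ h₀ > (0:ℝ), ∀ h, 0 < h → h ≤ h₀ → ∀ x ∈ K,
    |h⁻¹ * ((S h (ecoe f) x).toReal - f x) - g x| ≤ ε

/-- upper `ε`-parallel function -/
def parallel (κ : X → ℝ) (f : X → EReal) (ε : ℝ) : X → EReal :=
  fun x => (((κ x)⁻¹ : ℝ) : EReal) *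
    ((⨆ y ∈ Metric.closedBall x ε, max (f y * (κ y : EReal)) (((-ε⁻¹ : ℝ)) : EReal)) + (ε : EReal))

/-- upper semicontinuous envelope of the upper `ε`-parallel function -/
def parallelEnv (κ : X → ℝ) (f : X → EReal) (ε : ℝ) : X → EReal :=
  fun x => ⨅ (δ : ℝ) (_ : 0 < δ), ⨆ y ∈ Metric.closedBall x δ, parallel κ f ε y

end

noncomputable section

/-- truncation of an extended real to `ℝ≥0∞` -/
def erealToENNReal (x : EReal) : ℝ≥0∞ := if x = ⊤ then ⊤ else ENNReal.ofReal x.toReal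

/-- Lebesgue integral of an `EReal`-valued function on `(a,b]`, with values in `[-∞,∞]` -/
def eIntegral (a b : ℝ) (F : ℝ → EReal) : EReal :=
  ((∫⁻ s in Set.Ioc a b, erealToENNReal (max (F s) 0)) : ℝ≥0∞) -
  ((∫⁻ s in Set.Ioc a b, erealToENNReal (max (-F s) 0)) : ℝ≥0∞)

/-- convolution `f * μ` of an `EReal`-valued function with a measure -/
def econv {X : Type*} [NormedAddCommGroup X] [MeasurableSpace X]
    (μ : Measure X) (f : X → EReal) (x : X) : EReal :=
  ((∫⁻ y, erealToENNReal (max (f (x - y)) 0) ∂μ : ℝ≥0∞) : EReal) -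
  ((∫⁻ y, erealToENNReal (max (-f (x - y)) 0) ∂μ : ℝ≥0∞) : EReal)

/-- conjugate functional `φ*` -/
def dualConj {X : Type*} [MetricSpace X] [MeasurableSpace X]
    (κ : X → ℝ) (φ : (X → ℝ) → ℝ) (μ : Measure X) : EReal :=
  ⨆ f : {g : X → ℝ // MemCk κ g}, (((∫ x, f.1 x ∂μ) : ℝ) : EReal) - ((φ f.1 : ℝ) : EReal)

/-- the topology `σ(ca_κ⁺, C_κ)` on measures -/
def weakTopo {X : Type*} [MetricSpace X] [MeasurableSpace X] (κ : X → ℝ) :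
    TopologicalSpace (Measure X) :=
  TopologicalSpace.induced
    (fun μ => fun f : {g : X → ℝ // MemCk κ g} => ∫ x, f.1 x ∂μ) Pi.topologicalSpace

/-- `φ₁`, the extension of `φ` from `C_κ` to `U_κ` -/
def extUk {X : Type*} [MetricSpace X] (κ : X → ℝ) (φ : (X → ℝ) → ℝ) (f : X → EReal) : EReal :=
  ⨅ g : {g : X → ℝ // MemCk κ g ∧ ∀ x, f x ≤ (g x : EReal)}, ((φ g.1 : ℝ) : EReal)

end

theorem h_bdd_real {X : Type*} [MetricSpace X]
    {κ : X → ℝ} (hκpos : ∀ x, 0 < κ x) 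
    {S : ℝ → (X → EReal) → (X → EReal)} (hS : AssumptionS κ S) (r t : ℝ) (hr : 0 ≤ r) (ht : 0 ≤ t) :
    ∃ C : ℝ, 0 ≤ C ∧ ∀ s, 0 ≤ s → s ≤ t → ∀ f : X → ℝ, MemCk κ f → CkBound κ r f → ∀ x,
      ∃ y : ℝ, S s (ecoe f) x = (y : EReal) ∧ |y| * κ x ≤ C := by
  obtain ⟨C, hC, h⟩ := hS.bounded r t hr ht
  refine ⟨C.toReal, ENNReal.toReal_nonneg, fun s hs hst f hf hfr x => ?_⟩
  have h1 : (S s (ecoe f) x).abs * ENNReal.ofReal (κ x) ≤ C :=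
    (le_iSup (fun x => (S s (ecoe f) x).abs * ENNReal.ofReal (κ x)) x).trans (h s hs hst f hf hfr)
  have hk : ENNReal.ofReal (κ x) ≠ 0 := by simpa using hκpos x
  induction hy : S s (ecoe f) x with
  | bot => rw [hy, EReal.abs_bot, ENNReal.top_mul hk] at h1; exact absurd (top_le_iff.1 h1) hC
  | top => rw [hy, EReal.abs_top, ENNReal.top_mul hk] at h1; exact absurd (top_le_iff.1 h1) hC
  | coe y =>
    refine ⟨y, rfl, ?_⟩
    rw [hy, EReal.abs_def, ← ENNReal.ofReal_mul (abs_nonneg y)] at h1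
    exact (ENNReal.ofReal_le_iff_le_toReal hC).1 h1

theorem h_memUk_of_le {X : Type*} [MetricSpace X]
    {κ : X → ℝ} (hκpos : ∀ x, 0 < κ x) {F : X → EReal} (hF : UpperSemicontinuous F) {R : ℝ} (hR : 0 ≤ R)
    (h : ∀ x, F x ≤ ((R / κ x : ℝ) : EReal)) : MemUk κ F := by
  refine ⟨hF, fun x => (h x).trans_lt (EReal.coe_lt_top _), R, fun x => ?_⟩
  have h1 : max (F x) 0 ≤ ((R / κ x : ℝ) : EReal) :=
    max_le (h x) (by exact_mod_cast div_nonneg hR (hκpos x).le)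
  calc max (F x) 0 * (κ x : EReal) ≤ ((R / κ x : ℝ) : EReal) * (κ x : EReal) :=
        mul_le_mul_of_nonneg_right h1 (by exact_mod_cast (hκpos x).le)
    _ = (R : EReal) := by
        rw [← EReal.coe_mul, div_mul_cancel₀ _ (hκpos x).ne']

theorem h_memUk_ecoe {X : Type*} [MetricSpace X]
    {κ : X → ℝ} (hκpos : ∀ x, 0 < κ x) {f : X → ℝ} (hf : MemCk κ f) : MemUk κ (ecoe f) := by
  obtain ⟨hc, r, hr⟩ := hf
  refine h_memUk_of_le hκpos (R := max r 0) ?_ (le_max_right _ _) fun x => ?_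
  · exact (continuous_coe_real_ereal.comp hc).upperSemicontinuous
  · refine EReal.coe_le_coe_iff.2 ?_
    rw [le_div_iff₀ (hκpos x)]
    exact (mul_le_mul_of_nonneg_right (le_abs_self _) (hκpos x).le).trans ((hr x).trans (le_max_left _ _))

theorem h_step_lintegral (F : ℕ → ℝ≥0∞) (h : ℝ) (hh : 0 < h) (m : ℕ) :
    ∫⁻ s in Set.Ioc 0 (m * h), F (⌈s / h⌉₊ - 1) = ∑ k ∈ Finset.range m, F k * ENNReal.ofReal h := by
  induction m with
  | zero => simp
  | succ m ih =>
    have hU : Set.Ioc (0:ℝ) ((m + 1 : ℕ) * h) = Set.Ioc 0 (m * h) ∪ Set.Ioc (m * h) ((m + 1 : ℕ) * h) := by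
      rw [Set.Ioc_union_Ioc_eq_Ioc]
      · positivity
      · push_cast; nlinarith
    rw [hU, lintegral_union measurableSet_Ioc (Set.Ioc_disjoint_Ioc_of_le le_rfl), ih, Finset.sum_range_succ]
    congr 1
    rw [setLIntegral_congr_fun (g := fun _ => F m) measurableSet_Ioc]
    · rw [setLIntegral_const, Real.volume_Ioc]; congr 2; push_cast; ring
    · intro s hs
      have : ⌈s / h⌉₊ = m + 1 := by
        rw [Nat.ceil_eq_iff (by omega)]
        constructor
        · simpa [lt_div_iff₀ hh] using hs.1
        · rw [div_le_iff₀ hh]; exact hs.2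
      simp [this]

theorem h_limsup_usc {X : Type*} [MetricSpace X] (G : X → EReal) :
    UpperSemicontinuous (fun x => limsup G (𝓝 x)) := by
  intro x a ha
  obtain ⟨b, hb, hba⟩ := exists_between ha
  have h1 : ∀ᶠ y in 𝓝 x, G y < b := eventually_lt_of_limsup_lt hb
  filter_upwards [h1.eventually_nhds] with y hy
  exact (limsup_le_of_le (by isBoundedDefault) (hy.mono fun z hz => hz.le)).trans_lt hba

noncomputable def h_env {X : Type*} [MetricSpace X] (g : ℝ → X → EReal) (h₀ : ℝ) (N : ℕ) (x : X) : EReal :=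
  limsup (fun y => ⨆ h ∈ Set.Ioc 0 (h₀ / (N + 1)), g h y) (𝓝 x)

theorem h_env_le {X : Type*} [MetricSpace X] (g : ℝ → X → EReal) (h₀ : ℝ) (N : ℕ) (x : X)
    (h : ℝ) (hh : 0 < h) (hN : h ≤ h₀ / (N + 1)) : g h x ≤ h_env g h₀ N x := by
  have h1 : g h x ≤ ⨆ h ∈ Set.Ioc 0 (h₀ / (N + 1)), g h x :=
    le_iSup₂ (f := fun h (_ : h ∈ Set.Ioc 0 (h₀ / (N + 1))) => g h x) h ⟨hh, hN⟩
  refine h1.trans ?_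
  refine le_limsup_of_frequently_le' ?_
  intro hc
  exact hc.self_of_nhds le_rfl

theorem h_env_anti {X : Type*} [MetricSpace X] (g : ℝ → X → EReal) (h₀ : ℝ) (hh₀ : 0 < h₀) (x : X) :
    Antitone (fun N => h_env g h₀ N x) := by
  intro M N hMN
  refine limsup_le_limsup (Eventually.of_forall fun y => ?_)
  refine biSup_mono fun h hh => ⟨hh.1, hh.2.trans ?_⟩
  have : (M : ℝ) ≤ N := by exact_mod_cast hMN
  gcongr

theorem h_env_iInf {X : Type*} [MetricSpace X] (g : ℝ → X → EReal) (h₀ : ℝ) (hh₀ : 0 < h₀) (x : X) :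
    ⨅ N, h_env g h₀ N x = gammaLimsupZero g x := by
  apply le_antisymm
  · refine le_of_forall_lt fun a ha => ?_
    obtain ⟨b, hab, hb⟩ := exists_between ha
    have key : ∀ N : ℕ, ∃ h : ℝ, ∃ y : X, 0 < h ∧ h ≤ h₀ / (N + 1) ∧ dist y x < 1 / ((N : ℝ) + 1) ∧ b < g h y := by
      intro N
      have h1 : b < h_env g h₀ N x := hb.trans_le (iInf_le _ N)
      have h2 : ∃ᶠ y in 𝓝 x, b < ⨆ h ∈ Set.Ioc 0 (h₀ / ((N : ℝ) + 1)), g h y :=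
        frequently_lt_of_lt_limsup (by isBoundedDefault) h1
      have h3 : ∀ᶠ y in 𝓝 x, dist y x < 1 / ((N : ℝ) + 1) :=
        Metric.ball_mem_nhds x (by positivity)
      obtain ⟨y, hy1, hy2⟩ := (h2.and_eventually h3).exists
      obtain ⟨h, hh, hy3⟩ := lt_biSup_iff.1 hy1
      exact ⟨h, y, hh.1, hh.2, hy2, hy3⟩
    choose h y hpos hle hd hg using key
    have th : Tendsto h atTop (𝓝 0) := by
      refine squeeze_zero (fun n => (hpos n).le) hle ?_
      have := (tendsto_one_div_add_atTop_nhds_zero_nat (𝕜 := ℝ)).const_mul h₀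
      simpa [div_eq_mul_inv] using this
    have ty : Tendsto y atTop (𝓝 x) := by
      rw [tendsto_iff_dist_tendsto_zero]
      exact squeeze_zero (fun n => dist_nonneg) (fun n => (hd n).le)
        (tendsto_one_div_add_atTop_nhds_zero_nat (𝕜 := ℝ))
    have h4 : limsup (fun n => g (h n) (y n)) atTop ≤ gammaLimsupZero g x := by
      refine le_iSup_of_le h (le_iSup_of_le hpos (le_iSup_of_le th ?_))
      exact le_iSup_of_le y (le_iSup_of_le ty le_rfl)
    refine hab.trans_le (le_trans ?_ h4)
    exact le_limsup_of_frequently_le' (Frequently.of_forall fun n => (hg n).le)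
  · refine iSup_le fun h => iSup_le fun hpos => iSup_le fun th => iSup_le fun u => iSup_le fun hu => ?_
    refine le_iInf fun N => ?_
    have h1 : ∀ᶠ n in atTop, g (h n) (u n) ≤ ⨆ h ∈ Set.Ioc 0 (h₀ / ((N : ℝ) + 1)), g h (u n) := by
      have : ∀ᶠ n in atTop, h n ≤ h₀ / ((N : ℝ) + 1) := th.eventually_le_const (by positivity)
      filter_upwards [this] with n hn
      exact le_iSup₂ (f := fun h (_ : h ∈ Set.Ioc 0 (h₀ / ((N : ℝ) + 1))) => g h (u n)) (h n) ⟨hpos n, hn⟩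
    refine (limsup_le_limsup h1).trans ?_
    exact limsup_le_limsup_of_le (f := map u atTop) (u := fun y => ⨆ h ∈ Set.Ioc 0 (h₀ / ((N : ℝ) + 1)), g h y) hu

theorem h_env_bound {X : Type*} [MetricSpace X] {κ : X → ℝ} (hκc : Continuous κ) (hκpos : ∀ x, 0 < κ x)
    (g : ℝ → X → EReal) (h₀ c : ℝ) (hh₀ : 0 < h₀)
    (hg : ∀ h, 0 < h → h ≤ h₀ → ∀ x, g h x ≤ ((c / κ x : ℝ) : EReal)) (N : ℕ) (x : X) :
    h_env g h₀ N x ≤ ((c / κ x : ℝ) : EReal) := by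
  have hcont : Continuous (fun x => ((c / κ x : ℝ) : EReal)) :=
    continuous_coe_real_ereal.comp (continuous_const.div hκc fun x => (hκpos x).ne')
  rw [← (hcont.tendsto x).limsup_eq]
  refine limsup_le_limsup (Eventually.of_forall fun y => iSup₂_le fun h hh => hg h hh.1 (hh.2.trans ?_) y)
  exact div_le_self hh₀.le (by linarith [(Nat.cast_nonneg N : (0:ℝ) ≤ N)])

theorem h_mulAdd_cont (a b : ℝ) (ha : 0 < a) : Continuous (fun z : EReal => (a : EReal) * z + (b : EReal)) := by
  have ha' : (a : EReal) ≠ 0 := by exact_mod_cast ha.ne'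
  rw [continuous_iff_continuousAt]
  intro z
  have h1 : ContinuousAt (fun z : EReal => (a : EReal) * z) z :=
    ContinuousAt.comp (f := fun z : EReal => ((a : EReal), z)) (g := fun p : EReal × EReal => p.1 * p.2)
      (EReal.continuousAt_mul (Or.inl ha') (Or.inl ha') (Or.inl (EReal.coe_ne_bot _)) (Or.inl (EReal.coe_ne_top _)))
      (by fun_prop)
  exact ContinuousAt.comp (f := fun z : EReal => ((a : EReal) * z, (b : EReal))) (g := fun p : EReal × EReal => p.1 + p.2)
      (EReal.continuousAt_add (Or.inr (EReal.coe_ne_bot _)) (Or.inr (EReal.coe_ne_top _)))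
      (h1.prodMk continuousAt_const)

theorem h_mulAdd_mono (a b : ℝ) (ha : 0 < a) : Monotone (fun z : EReal => (a : EReal) * z + (b : EReal)) := by
  intro z w hzw
  have : (0 : EReal) ≤ a := by exact_mod_cast ha.le
  exact add_le_add (mul_le_mul_of_nonneg_left hzw this) le_rfl

theorem h_mulAdd_usc {X : Type*} [MetricSpace X] {F : X → EReal} (hF : UpperSemicontinuous F)
    {f : X → ℝ} (hf : Continuous f) (a : ℝ) (ha : 0 < a) :
    UpperSemicontinuous (fun y => (a : EReal) * F y + (f y : EReal)) := by
  have h1 : UpperSemicontinuous (fun y => (a : EReal) * F y) := by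
    have h1 := (h_mulAdd_cont a 0 ha).comp_upperSemicontinuous hF (h_mulAdd_mono a 0 ha)
    simpa [Function.comp_def] using h1
  exact h1.add' (continuous_coe_real_ereal.comp hf).upperSemicontinuous
    (fun x => EReal.continuousAt_add (Or.inr (EReal.coe_ne_bot _)) (Or.inr (EReal.coe_ne_top _)))

theorem h_subM_cont (M : ℝ) : Continuous (fun z : EReal => ((M : EReal) - z).toENNReal) := by
  refine EReal.continuous_toENNReal.comp ?_
  rw [continuous_iff_continuousAt]
  intro z
  show ContinuousAt (fun z : EReal => (M : EReal) + -z) z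
  exact ContinuousAt.comp (f := fun z : EReal => ((M : EReal), -z)) (g := fun p : EReal × EReal => p.1 + p.2)
      (EReal.continuousAt_add (Or.inl (EReal.coe_ne_top _)) (Or.inl (EReal.coe_ne_bot _)))
      (by fun_prop)

theorem h_subM_anti (M : ℝ) : Antitone (fun z : EReal => ((M : EReal) - z).toENNReal) := by
  intro z w hzw
  exact EReal.toENNReal_le_toENNReal (EReal.sub_le_sub le_rfl hzw)

theorem h_eIntegral_ge (t M b : ℝ) (ht : 0 < t) (hM : 0 ≤ M) (φ : ℝ → EReal)
    (hφ : AEMeasurable φ (volume.restrict (Set.Ioc 0 t)))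
    (hle : ∀ s ∈ Set.Ioc 0 t, φ s ≤ M) (hb : b ≤ M * t)
    (hI : ∫⁻ s in Set.Ioc 0 t, ((M : EReal) - φ s).toENNReal ≤ ENNReal.ofReal (M * t - b)) :
    (b : EReal) ≤ eIntegral 0 t φ := by
  have e : ∀ z, erealToENNReal z = z.toENNReal := fun z => rfl
  unfold eIntegral
  simp only [e]
  set P := ∫⁻ s in Set.Ioc 0 t, (max (φ s) 0).toENNReal with hP
  set N := ∫⁻ s in Set.Ioc 0 t, (max (-φ s) 0).toENNReal with hN
  set I := ∫⁻ s in Set.Ioc 0 t, ((M : EReal) - φ s).toENNReal with hI'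
  have mP : AEMeasurable (fun s => (max (φ s) 0).toENNReal) (volume.restrict (Set.Ioc 0 t)) :=
    EReal.continuous_toENNReal.measurable.comp_aemeasurable (hφ.max aemeasurable_const)
  have hconst : ∫⁻ s in Set.Ioc 0 t, ENNReal.ofReal M = ENNReal.ofReal (M * t) := by
    rw [setLIntegral_const, Real.volume_Ioc, sub_zero, ← ENNReal.ofReal_mul hM]
  have h1 : I + P = ENNReal.ofReal (M * t) + N := by
    rw [hI', hP, hN, ← hconst, ← lintegral_add_right' _ mP, ← lintegral_add_left measurable_const]
    refine setLIntegral_congr_fun measurableSet_Ioc fun s hs => ?_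
    have := hle s hs
    show ((M : EReal) - φ s).toENNReal + (max (φ s) 0).toENNReal = ENNReal.ofReal M + (max (-φ s) 0).toENNReal
    induction hs : φ s with
    | bot => simp
    | top => rw [hs] at this; simp at this
    | coe y =>
      rw [hs] at this
      have hy : y ≤ M := by exact_mod_cast this
      have e1 : max (y : EReal) 0 = ((max y 0 : ℝ) : EReal) := by
        rw [← EReal.coe_zero]; exact (EReal.coe_strictMono.monotone.map_max).symm
      have e2 : max (-(y : EReal)) 0 = ((max (-y) 0 : ℝ) : EReal) := by
        rw [← EReal.coe_zero, ← EReal.coe_neg]; exact (EReal.coe_strictMono.monotone.map_max).symm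
      rw [e1, e2, ← EReal.coe_sub]
      simp only [EReal.toENNReal_of_ne_top (EReal.coe_ne_top _), EReal.toReal_coe]
      rw [← ENNReal.ofReal_add (by linarith) (le_max_right _ _), ← ENNReal.ofReal_add hM (le_max_right _ _)]
      congr 1
      rcases le_total y 0 with h | h
      · rw [max_eq_right h, max_eq_left (by linarith)]; ring
      · rw [max_eq_left h, max_eq_right (by linarith)]; ring
  have hPfin : P ≠ ⊤ := by
    refine ne_top_of_le_ne_top (b := ENNReal.ofReal (M * t)) ENNReal.ofReal_ne_top ?_
    rw [hP, ← hconst]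
    refine setLIntegral_mono' measurableSet_Ioc fun s hs => ?_
    have : max (φ s) 0 ≤ (M : EReal) := max_le (hle s hs) (by exact_mod_cast hM)
    simpa [EReal.toENNReal_of_ne_top (EReal.coe_ne_top _)] using EReal.toENNReal_le_toENNReal this
  have hIfin : I ≠ ⊤ := ne_top_of_le_ne_top ENNReal.ofReal_ne_top hI
  have hNfin : N ≠ ⊤ := by
    intro hc
    rw [hc, add_top] at h1
    exact ENNReal.add_ne_top.2 ⟨hIfin, hPfin⟩ h1
  have hIr : I.toReal ≤ M * t - b := ENNReal.toReal_le_of_le_ofReal (by linarith) hI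
  have h2 := congrArg ENNReal.toReal h1
  rw [ENNReal.toReal_add hIfin hPfin, ENNReal.toReal_add ENNReal.ofReal_ne_top hNfin,
    ENNReal.toReal_ofReal (by positivity)] at h2
  rw [← EReal.coe_ennreal_toReal hPfin, ← EReal.coe_ennreal_toReal hNfin, ← EReal.coe_sub]
  refine EReal.coe_le_coe_iff.2 ?_
  linarith

theorem h_meas {X : Type*} [MetricSpace X] {κ : X → ℝ}
    {S : ℝ → (X → EReal) → (X → EReal)} (hS : AssumptionS κ S) {Q : X → EReal} (hQ : MemUk κ Q)
    (x : X) (t : ℝ) : AEMeasurable (fun s => S s Q x) (volume.restrict (Set.Ioc 0 t)) := by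
  have h1 : UpperSemicontinuous (fun s => S (max s 0) Q x) := by
    intro s a ha
    by_contra hc
    have hc' : ∃ᶠ s' in 𝓝 s, a ≤ S (max s' 0) Q x := by
      intro hn
      exact hc (hn.mono fun z hz => not_le.1 hz)
    obtain ⟨u, hu, hua⟩ := exists_seq_forall_of_frequently hc'
    have h2 := hS.gammaUsc (max s 0) (le_max_right _ _) Q hQ x
    have h3 : a ≤ gammaLimsupAt (fun s => S s Q) (max s 0) x := by
      refine le_iSup_of_le (fun n => max (u n) 0) (le_iSup_of_le (fun n => le_max_right _ _)
        (le_iSup_of_le (hu.max tendsto_const_nhds) (le_iSup_of_le (fun _ => x)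
          (le_iSup_of_le tendsto_const_nhds ?_))))
      exact le_limsup_of_frequently_le' (Frequently.of_forall fun n => hua n)
    exact absurd (h3.trans h2) (not_le.2 ha)
  refine AEMeasurable.congr h1.measurable.aemeasurable ?_
  filter_upwards [ae_restrict_mem measurableSet_Ioc] with s hs
  rw [max_eq_left hs.1.le]

theorem h_key {X : Type*} [MetricSpace X] {κ : X → ℝ} (hκc : Continuous κ) (hκpos : ∀ x, 0 < κ x)
    {S : ℝ → (X → EReal) → (X → EReal)} (hS : AssumptionS κ S)
    (g : ℝ → X → EReal) (h₀ c r : ℝ) (hh₀ : 0 < h₀) (hc : 0 ≤ c) (hr : 0 ≤ r)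
    (hg : ∀ h, 0 < h → h ≤ h₀ → ∀ x, g h x ≤ ((c / κ x : ℝ) : EReal))
    (f : X → ℝ) (hf : Continuous f) (hfr : CkBound κ r f) (a : ℝ) (ha : 0 < a) :
    MemUk κ (fun y => (a : EReal) * gammaLimsupZero g y + (f y : EReal)) ∧
    (∀ y, (a : EReal) * gammaLimsupZero g y + (f y : EReal) ≤ (((a * c + r) / κ y : ℝ) : EReal)) ∧
    (∀ h, 0 < h → h ≤ h₀ → ∀ y, (a : EReal) * g h y + (f y : EReal) ≤ (((a * c + r) / κ y : ℝ) : EReal)) ∧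
    ∀ (s : ℝ) (_ : 0 ≤ s) (u : ℕ → ℝ) (_ : ∀ n, 0 ≤ u n) (_ : Tendsto u atTop (𝓝 s))
      (h : ℕ → ℝ) (_ : ∀ n, 0 < h n) (_ : Tendsto h atTop (𝓝 0))
      (_ : ∀ n, MemUk κ (fun y => (a : EReal) * g (h n) y + (f y : EReal))) (x : X),
      limsup (fun n => S (u n) (fun y => (a : EReal) * g (h n) y + (f y : EReal)) x) atTop ≤
        S s (fun y => (a : EReal) * gammaLimsupZero g y + (f y : EReal)) x := by
  have hbd : ∀ (y : X) (z : EReal), z ≤ ((c / κ y : ℝ) : EReal) →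
      (a : EReal) * z + (f y : EReal) ≤ (((a * c + r) / κ y : ℝ) : EReal) := by
    intro y z hz
    refine (h_mulAdd_mono a (f y) ha hz).trans ?_
    show (a : EReal) * ((c / κ y : ℝ) : EReal) + (f y : EReal) ≤ (((a * c + r) / κ y : ℝ) : EReal)
    rw [← EReal.coe_mul, ← EReal.coe_add]
    refine EReal.coe_le_coe_iff.2 ?_
    have h1 : f y ≤ r / κ y := by
      rw [le_div_iff₀ (hκpos y)]
      exact (mul_le_mul_of_nonneg_right (le_abs_self _) (hκpos y).le).trans (hfr y)
    rw [add_div, mul_div_assoc]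
    linarith
  have hR : 0 ≤ a * c + r := by positivity
  have hQ : ∀ N, MemUk κ (fun y => (a : EReal) * h_env g h₀ N y + (f y : EReal)) := fun N =>
    h_memUk_of_le hκpos (h_mulAdd_usc (h_limsup_usc _) hf a ha) hR
      (fun y => hbd y _ (h_env_bound hκc hκpos g h₀ c hh₀ hg N y))
  have hgen : gammaLimsupZero g = fun y => ⨅ N, h_env g h₀ N y := by
    funext y; rw [h_env_iInf g h₀ hh₀ y]
  have hgle : ∀ y, gammaLimsupZero g y ≤ ((c / κ y : ℝ) : EReal) := by
    intro y
    rw [hgen]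
    exact (iInf_le _ 0).trans (h_env_bound hκc hκpos g h₀ c hh₀ hg 0 y)
  have hQi : MemUk κ (fun y => (a : EReal) * gammaLimsupZero g y + (f y : EReal)) := by
    refine h_memUk_of_le hκpos (h_mulAdd_usc ?_ hf a ha) hR (fun y => hbd y _ (hgle y))
    rw [hgen]
    exact upperSemicontinuous_iInf fun N => h_limsup_usc _
  refine ⟨hQi, fun y => hbd y _ (hgle y), fun h hh hhh y => hbd y _ (hg h hh hhh y), ?_⟩
  intro s hs u hu0 hu h hh0 hh hm x
  rw [← hS.contAbove s hs (fun N y => (a : EReal) * h_env g h₀ N y + (f y : EReal)) _ hQ hQi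
    (fun y M N hMN => h_mulAdd_mono a (f y) ha (h_env_anti g h₀ hh₀ y hMN)) ?_ x]
  · refine le_iInf fun N => ?_
    refine le_trans ?_ (hS.gammaUsc s hs _ (hQ N) x)
    refine le_iSup_of_le u (le_iSup_of_le hu0
        (le_iSup_of_le hu (le_iSup_of_le (fun _ => x)
          (le_iSup_of_le tendsto_const_nhds ?_))))
    refine limsup_le_limsup ?_
    have : ∀ᶠ n in atTop, h n ≤ h₀ / ((N : ℝ) + 1) := hh.eventually_le_const (by positivity)
    filter_upwards [this] with n hn
    refine hS.monotone (u n) (hu0 n) _ _ (hm n) (hQ N) (fun y => ?_) x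
    exact h_mulAdd_mono a (f y) ha (h_env_le g h₀ N y (h n) (hh0 n) hn)
  · intro y
    refine iInf_eq_of_tendsto (fun M N hMN => h_mulAdd_mono a (f y) ha (h_env_anti g h₀ hh₀ y hMN)) ?_
    have h1 := tendsto_atTop_iInf (h_env_anti g h₀ hh₀ y)
    rw [h_env_iInf g h₀ hh₀ y] at h1
    exact ((h_mulAdd_cont a (f y) ha).tendsto _).comp h1

theorem h_tele {X : Type*} [MetricSpace X] {κ : X → ℝ} (hκpos : ∀ x, 0 < κ x)
    {S : ℝ → (X → EReal) → (X → EReal)} (hS : AssumptionS κ S) (f : X → ℝ) (hf : MemCk κ f)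
    (hsg : ∀ s t, 0 ≤ s → 0 ≤ t → S (s + t) (ecoe f) = S s (S t (ecoe f)))
    (lam h : ℝ) (hlam : 0 < lam) (hh : 0 < h) (hlh : h * lam ≤ 1) (g1 q : X → ℝ)
    (hq : MemCk κ q) (hg1 : S h (ecoe f) = ecoe g1)
    (hq1 : ∀ y, q y = lam⁻¹ * (h⁻¹ * (g1 y - f y)) + f y) (x : X) (A B : ℕ → ℝ) (m : ℕ)
    (hA : ∀ k ≤ m, S (k * h) (ecoe f) x = (A k : EReal))
    (hB : ∀ k < m, S (k * h) (ecoe q) x = (B k : EReal)) :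
    A m - f x ≤ lam * (h * ∑ k ∈ Finset.range m, B k) - lam * (h * ∑ k ∈ Finset.range m, A k) := by
  have hA0 : A 0 = f x := by
    have := hA 0 (Nat.zero_le _)
    rw [Nat.cast_zero, zero_mul, hS.idZero _ (h_memUk_ecoe hκpos hf)] at this
    exact (EReal.coe_eq_coe_iff.1 this).symm
  have step : ∀ k < m, A (k + 1) - A k ≤ lam * h * (B k - A k) := by
    intro k hk
    have h1 := hA (k + 1) hk
    have hk0 : (0:ℝ) ≤ k * h := by positivity
    have e : ((k + 1 : ℕ) : ℝ) * h = k * h + h := by push_cast; ring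
    rw [e, hsg _ _ hk0 hh.le, hg1] at h1
    have e2 : ecoe g1 = fun y => ((h * lam : ℝ) : EReal) * ecoe q y + ((1 - h * lam : ℝ) : EReal) * ecoe f y := by
      funext y
      simp only [ecoe]
      rw [← EReal.coe_mul, ← EReal.coe_mul, ← EReal.coe_add, hq1]
      congr 1
      field_simp
      ring
    have h2 := hS.convex _ hk0 (ecoe q) (ecoe f) (h_memUk_ecoe hκpos hq) (h_memUk_ecoe hκpos hf)
      (h * lam) (by positivity) hlh x
    rw [← e2, h1, hB k hk, hA k hk.le, ← EReal.coe_mul, ← EReal.coe_mul, ← EReal.coe_add,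
      EReal.coe_le_coe_iff] at h2
    linarith
  rw [← hA0, ← Finset.sum_range_sub, ← mul_assoc, ← mul_assoc, ← mul_sub, ← Finset.sum_sub_distrib, Finset.mul_sum]
  exact Finset.sum_le_sum fun k hk => step k (Finset.mem_range.1 hk)
/-- integral upper bound for `S(t)f - f` in terms of the upper
`Γ`-generator. -/
theorem stmt11
    {X : Type*} [MetricSpace X] [CompleteSpace X] [TopologicalSpace.SeparableSpace X]
    (κ : X → ℝ) (hκc : Continuous κ) (hκpos : ∀ x, 0 < κ x) (hκbd : ∃ C, ∀ x, κ x ≤ C)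
    (S : ℝ → (X → EReal) → (X → EReal)) (hS : AssumptionS κ S)
    (r T : ℝ) (hr : 0 ≤ r) (hT : 0 ≤ T) (ε : ℝ) (hε : 0 < ε) :
    ∃ lam₀ : ℝ, 0 < lam₀ ∧ lam₀ ≤ 1 ∧
      ∀ t, 0 ≤ t → t ≤ T → ∀ f : X → ℝ, MemCk κ f → CkBound κ r f → UpperLip κ S f →
        ∀ lam : ℝ, 0 < lam → lam ≤ lam₀ → ∀ x,
          S t (ecoe f) x - (f x : EReal) ≤
            (lam : EReal) *
              eIntegral 0 t (fun s =>
                S s (fun y => ((lam⁻¹ : ℝ) : EReal) * uppGen S f y + (f y : EReal)) x)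
            + ((ε * t / κ x : ℝ) : EReal) := by

  obtain ⟨C, hC0, hC⟩ := h_bdd_real hκpos hS r T hr hT
  refine ⟨min 1 (ε / (C + 1)), lt_min one_pos (by positivity), min_le_left _ _, ?_⟩
  intro t ht0 htT f hf hfr hU lam hlam hlam0 x
  have hκx := hκpos x
  have hlam1 : lam ≤ 1 := hlam0.trans (min_le_left _ _)
  have hlamC : lam * C ≤ ε := by
    have h1 : lam ≤ ε / (C + 1) := hlam0.trans (min_le_right _ _)
    rw [le_div_iff₀ (by positivity)] at h1
    nlinarith
  rcases ht0.eq_or_lt with rfl | ht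
  · rw [hS.idZero _ (h_memUk_ecoe hκpos hf)]
    have h1 : ecoe f x - (f x : EReal) = 0 := by
      show (f x : EReal) - (f x : EReal) = 0
      rw [← EReal.coe_sub, sub_self, EReal.coe_zero]
    rw [h1]
    simp [eIntegral]
  obtain ⟨-, hCk, hsg, h₀, hh₀, c, hc, hL⟩ := hU
  choose g hgm hge using hCk
  have hquot : ∀ h, 0 < h → h ≤ h₀ → ∀ y, diffQuot S f h y ≤ ((c / κ y : ℝ) : EReal) := by
    intro h hh hhh y
    have h1 := hL h hh.le hhh y
    have hκy := hκpos y
    unfold diffQuot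
    rw [hge h hh.le y] at h1 ⊢
    have h2 : ((g h hh.le y : EReal) - (f y : EReal)) * (κ y : EReal) ≤ ((c * h : ℝ) : EReal) :=
      (mul_le_mul_of_nonneg_right (le_max_left _ _) (by exact_mod_cast hκy.le)).trans h1
    rw [← EReal.coe_sub, ← EReal.coe_mul, EReal.coe_le_coe_iff] at h2
    rw [← EReal.coe_sub, ← EReal.coe_mul, EReal.coe_le_coe_iff, le_div_iff₀ hκy]
    rw [mul_assoc, inv_mul_le_iff₀ hh]
    linarith
  have hlaminv : 0 < lam⁻¹ := inv_pos.2 hlam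
  obtain ⟨hQ, hQle, hqle, hlim⟩ := h_key hκc hκpos hS (diffQuot S f) h₀ c r hh₀ hc hr hquot f hf.1 hfr lam⁻¹ hlaminv
  set R := lam⁻¹ * c + r with hR
  have hR0 : 0 ≤ R := by positivity
  obtain ⟨C2, hC20, hC2⟩ := h_bdd_real hκpos hS R T hR0 hT
  have hRk : MemCk κ (fun y => R / κ y) ∧ CkBound κ R (fun y => R / κ y) := by
    have h1 : ∀ y, |R / κ y| * κ y ≤ R := fun y => by
      rw [abs_of_nonneg (div_nonneg hR0 (hκpos y).le), div_mul_cancel₀ _ (hκpos y).ne']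
    exact ⟨⟨continuous_const.div hκc fun y => (hκpos y).ne', R, h1⟩, h1⟩
  set M := C2 / κ x with hM
  have hM0 : 0 ≤ M := by positivity
  have hSM : ∀ s, 0 ≤ s → s ≤ T → ∀ F, MemUk κ F → (∀ y, F y ≤ ((R / κ y : ℝ) : EReal)) →
      S s F x ≤ (M : EReal) := by
    intro s hs hsT F hF hFle
    refine (hS.monotone s hs F (ecoe fun y => R / κ y) hF (h_memUk_ecoe hκpos hRk.1) hFle x).trans ?_
    obtain ⟨y, hy, hyC⟩ := hC2 s hs hsT _ hRk.1 hRk.2 x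
    rw [hy, EReal.coe_le_coe_iff, hM, le_div_iff₀ hκx]
    exact (mul_le_mul_of_nonneg_right (le_abs_self _) hκx.le).trans hyC
  obtain ⟨N₀, hN₀⟩ : ∃ N₀ : ℕ, t / (min h₀ 1) ≤ N₀ := exists_nat_ge _
  have hmin : 0 < min h₀ 1 := lt_min hh₀ one_pos
  set m : ℕ → ℕ := fun n => n + N₀ + 1 with hm
  set h : ℕ → ℝ := fun n => t / (m n : ℝ) with hh
  have hmpos : ∀ n, (0:ℝ) < m n := fun n => by simp only [hm]; positivity
  have hpos : ∀ n, 0 < h n := fun n => div_pos ht (hmpos n)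
  have hmh : ∀ n, (m n : ℝ) * h n = t := fun n => mul_div_cancel₀ _ (hmpos n).ne'
  have hle : ∀ n, h n ≤ min h₀ 1 := by
    intro n
    rw [hh, div_le_iff₀ (hmpos n)]
    rw [div_le_iff₀ hmin] at hN₀
    have : (N₀ : ℝ) ≤ m n := by simp only [hm]; push_cast; linarith [(Nat.cast_nonneg n : (0:ℝ) ≤ n)]
    nlinarith
  have htend : Tendsto h atTop (𝓝 0) := by
    refine squeeze_zero (fun n => (hpos n).le) (g := fun n : ℕ => t * (1 / ((n : ℝ) + 1))) (fun n => ?_) ?_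
    · rw [mul_one_div]
      simp only [hh, hm]
      push_cast
      gcongr
      linarith [(Nat.cast_nonneg N₀ : (0:ℝ) ≤ N₀)]
    · simpa using (tendsto_one_div_add_atTop_nhds_zero_nat (𝕜 := ℝ)).const_mul t
  set q : ℕ → X → ℝ := fun n y => lam⁻¹ * ((h n)⁻¹ * (g (h n) (hpos n).le y - f y)) + f y with hq
  have hqm : ∀ n, MemCk κ (q n) := by
    intro n
    obtain ⟨hgc, rg, hrg⟩ := hgm (h n) (hpos n).le
    refine ⟨?_, lam⁻¹ * ((h n)⁻¹ * (rg + r)) + r, fun y => ?_⟩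
    · have := hf.1
      simp only [hq]
      fun_prop
    · have hi : 0 < (h n)⁻¹ := inv_pos.2 (hpos n)
      have h1 : |q n y| ≤ lam⁻¹ * ((h n)⁻¹ * (|g (h n) (hpos n).le y| + |f y|)) + |f y| := by
        simp only [hq]
        refine (abs_add_le _ _).trans ?_
        rw [abs_mul, abs_mul, abs_of_pos hlaminv, abs_of_pos hi]
        gcongr
        exact abs_sub _ _
      refine (mul_le_mul_of_nonneg_right h1 (hκpos y).le).trans ?_
      have e : (lam⁻¹ * ((h n)⁻¹ * (|g (h n) (hpos n).le y| + |f y|)) + |f y|) * κ y =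
        lam⁻¹ * ((h n)⁻¹ * (|g (h n) (hpos n).le y| * κ y + |f y| * κ y)) + |f y| * κ y := by ring
      rw [e]
      gcongr
      · exact hrg y
      · exact hfr y
      · exact hfr y
  have hqe : ∀ n, ecoe (q n) = fun y => ((lam⁻¹ : ℝ) : EReal) * diffQuot S f (h n) y + (f y : EReal) := by
    intro n
    funext y
    show ((q n y : ℝ) : EReal) = ((lam⁻¹ : ℝ) : EReal) *
      ((((h n)⁻¹ : ℝ) : EReal) * (S (h n) (ecoe f) y - (f y : EReal))) + (f y : EReal)
    rw [hge (h n) (hpos n).le y, ← EReal.coe_sub, ← EReal.coe_mul, ← EReal.coe_mul, ← EReal.coe_add]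
  have hBex : ∀ n s, 0 ≤ s → s ≤ T → ∃ y : ℝ, S s (ecoe (q n)) x = (y : EReal) := by
    intro n s hs hsT
    obtain ⟨hqc, rq, hrq⟩ := hqm n
    have hrq0 : 0 ≤ rq := (mul_nonneg (abs_nonneg (q n x)) hκx.le).trans (hrq x)
    obtain ⟨C3, -, hC3⟩ := h_bdd_real hκpos hS rq T hrq0 hT
    obtain ⟨y, hy, -⟩ := hC3 s hs hsT (q n) ⟨hqc, rq, hrq⟩ hrq x
    exact ⟨y, hy⟩
  have hkT : ∀ n k, k ≤ m n → (0:ℝ) ≤ k * h n ∧ (k:ℝ) * h n ≤ T := by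
    intro n k hk
    refine ⟨mul_nonneg (Nat.cast_nonneg _) (hpos n).le, le_trans ?_ htT⟩
    rw [← hmh n]
    have : (k:ℝ) ≤ m n := by exact_mod_cast hk
    exact mul_le_mul_of_nonneg_right this (hpos n).le
  set A : ℕ → ℕ → ℝ := fun n k => (S (k * h n) (ecoe f) x).toReal with hAdef
  set B : ℕ → ℕ → ℝ := fun n k => (S (k * h n) (ecoe (q n)) x).toReal with hBdef
  have hA : ∀ n k, k ≤ m n → S (k * h n) (ecoe f) x = (A n k : EReal) ∧ |A n k| * κ x ≤ C := by
    intro n k hk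
    obtain ⟨y, hy, hy2⟩ := hC _ (hkT n k hk).1 (hkT n k hk).2 f hf hfr x
    have : A n k = y := by simp only [hAdef]; rw [hy, EReal.toReal_coe]
    rw [this]
    exact ⟨hy, hy2⟩
  have hB : ∀ n k, k ≤ m n → S (k * h n) (ecoe (q n)) x = (B n k : EReal) := by
    intro n k hk
    obtain ⟨y, hy⟩ := hBex n _ (hkT n k hk).1 (hkT n k hk).2
    have : B n k = y := by simp only [hBdef]; rw [hy, EReal.toReal_coe]
    rw [this, hy]
  have hqU : ∀ n, MemUk κ (ecoe (q n)) := fun n => h_memUk_ecoe hκpos (hqm n)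
  have hqR : ∀ n y, ecoe (q n) y ≤ ((R / κ y : ℝ) : EReal) := by
    intro n y
    rw [hqe n]
    exact hqle (h n) (hpos n) ((hle n).trans (min_le_left _ _)) y
  have hBM : ∀ n k, k ≤ m n → B n k ≤ M := by
    intro n k hk
    have := hSM _ (hkT n k hk).1 (hkT n k hk).2 (ecoe (q n)) (hqU n) (hqR n)
    rw [hB n k hk] at this
    exact_mod_cast this
  obtain ⟨a, ha, -⟩ := hC t ht.le htT f hf hfr x
  have hAm : ∀ n, A n (m n) = a := by
    intro n
    simp only [hAdef]
    rw [hmh, ha, EReal.toReal_coe]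
  set b : ℝ := (a - f x - ε * t / κ x) / lam with hb
  have hbsum : ∀ n, b ≤ h n * ∑ k ∈ Finset.range (m n), B n k := by
    intro n
    have h1 := h_tele hκpos hS f hf hsg lam (h n) hlam (hpos n)
      (mul_le_one₀ ((hle n).trans (min_le_right _ _)) hlam.le hlam1)
      (g (h n) (hpos n).le) (q n) (hqm n) (funext fun y => hge (h n) (hpos n).le y) (fun y => rfl) x
      (A n) (B n) (m n) (fun k hk => (hA n k hk).1) (fun k hk => hB n k hk.le)
    rw [hAm n] at h1
    have h2 : -(m n * (C / κ x)) ≤ ∑ k ∈ Finset.range (m n), A n k := by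
      have : ∑ k ∈ Finset.range (m n), (-(C / κ x)) ≤ ∑ k ∈ Finset.range (m n), A n k := by
        refine Finset.sum_le_sum fun k hk => ?_
        have h3 := (hA n k (Finset.mem_range.1 hk).le).2
        rw [← le_div_iff₀ hκx] at h3
        exact (abs_le.1 h3).1
      simpa using this
    have h3 : -(t * (C / κ x)) ≤ h n * ∑ k ∈ Finset.range (m n), A n k := by
      have := mul_le_mul_of_nonneg_left h2 (hpos n).le
      have e : h n * -(m n * (C / κ x)) = -(t * (C / κ x)) := by rw [← hmh n]; ring
      linarith
    have h4 : -(lam * (h n * ∑ k ∈ Finset.range (m n), A n k)) ≤ ε * t / κ x := by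
      have h5 := mul_le_mul_of_nonneg_left h3 hlam.le
      have h6 : lam * (t * (C / κ x)) ≤ ε * t / κ x := by
        have : lam * (t * (C / κ x)) = (lam * C) * t / κ x := by ring
        rw [this]
        gcongr
      linarith
    rw [hb, div_le_iff₀ hlam]
    linarith
  have hbM : b ≤ M * t := by
    refine (hbsum 0).trans ?_
    have : ∑ k ∈ Finset.range (m 0), B 0 k ≤ ∑ k ∈ Finset.range (m 0), M :=
      Finset.sum_le_sum fun k hk => hBM 0 k (Finset.mem_range.1 hk).le
    have h2 := mul_le_mul_of_nonneg_left this (hpos 0).le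
    refine h2.trans (le_of_eq ?_)
    rw [← hmh 0]
    simp
    ring
  have hstep : ∀ n, ∫⁻ s in Set.Ioc 0 t, ((M : EReal) - (B n (⌈s / h n⌉₊ - 1) : ℝ)).toENNReal
      ≤ ENNReal.ofReal (M * t - b) := by
    intro n
    have h1 := h_step_lintegral (fun k => ((M : EReal) - (B n k : ℝ)).toENNReal) (h n) (hpos n) (m n)
    rw [hmh n] at h1
    rw [h1]
    have h2 : ∀ k ∈ Finset.range (m n), ((M : EReal) - (B n k : ℝ)).toENNReal * ENNReal.ofReal (h n)
        = ENNReal.ofReal ((M - B n k) * h n) := by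
      intro k hk
      have := hBM n k (Finset.mem_range.1 hk).le
      rw [← EReal.coe_sub, EReal.toENNReal_of_ne_top (EReal.coe_ne_top _), EReal.toReal_coe,
        ← ENNReal.ofReal_mul (by linarith)]
    rw [Finset.sum_congr rfl h2, ← ENNReal.ofReal_sum_of_nonneg]
    · refine ENNReal.ofReal_le_ofReal ?_
      have h3 := hbsum n
      have h4 : ∑ k ∈ Finset.range (m n), (M - B n k) * h n
          = M * t - h n * ∑ k ∈ Finset.range (m n), B n k := by
        rw [← Finset.sum_mul, Finset.sum_sub_distrib, ← hmh n]
        simp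
        ring
      linarith
    · intro k hk
      have := hBM n k (Finset.mem_range.1 hk).le
      exact mul_nonneg (by linarith) (hpos n).le
  have hfinal : (b : EReal) ≤ eIntegral 0 t (fun s =>
      S s (fun y => ((lam⁻¹ : ℝ) : EReal) * uppGen S f y + (f y : EReal)) x) := by
    refine h_eIntegral_ge t M b ht hM0 _ (h_meas hS hQ x t)
      (fun s hs => hSM s hs.1.le (hs.2.trans htT) _ hQ hQle) hbM ?_
    have hF : ∫⁻ s in Set.Ioc 0 t, liminf (fun n => ((M : EReal) - (B n (⌈s / h n⌉₊ - 1) : ℝ)).toENNReal) atTop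
        ≤ ENNReal.ofReal (M * t - b) := by
      refine (lintegral_liminf_le fun n => ?_).trans ?_
      · have h1 : Measurable (fun s : ℝ => ⌈s / h n⌉₊) := Nat.measurable_ceil.comp (measurable_id.div_const _)
        exact (measurable_from_nat (f := fun k => ((M : EReal) - (B n (k - 1) : ℝ)).toENNReal)).comp h1
      · exact liminf_le_of_le (by isBoundedDefault) fun c hc => by
          obtain ⟨n, hn⟩ := hc.exists
          exact hn.trans (hstep n)
    refine le_trans (setLIntegral_mono' measurableSet_Ioc fun s hs => ?_) hF
    have hceil : ∀ n, ((⌈s / h n⌉₊ - 1 : ℕ) : ℝ) = ⌈s / h n⌉₊ - 1 := by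
      intro n
      have : 0 < ⌈s / h n⌉₊ := Nat.ceil_pos.2 (div_pos hs.1 (hpos n))
      rw [Nat.cast_sub this]
      simp
    have hidx : ∀ n, ⌈s / h n⌉₊ - 1 ≤ m n := by
      intro n
      have : ⌈s / h n⌉₊ ≤ m n := by
        rw [Nat.ceil_le, div_le_iff₀ (hpos n), hmh n]
        exact hs.2
      omega
    have hl := hlim s hs.1.le (fun n => ((⌈s / h n⌉₊ - 1 : ℕ) : ℝ) * h n)
      (fun n => (hkT n _ (hidx n)).1) ?_ h hpos htend (fun n => by rw [← hqe n]; exact hqU n) x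
    · simp only [← hqe] at hl
      simp only [hB _ _ (hidx _)] at hl
      have h2 := h_subM_anti M hl
      refine h2.trans (le_of_eq ?_)
      exact (h_subM_anti M).map_limsup_of_continuousAt _ (h_subM_cont M).continuousAt
    · have hlow : Tendsto (fun n => s - h n) atTop (𝓝 s) := by
        simpa using (tendsto_const_nhds (x := s)).sub htend
      refine tendsto_of_tendsto_of_tendsto_of_le_of_le hlow tendsto_const_nhds (fun n => ?_) (fun n => ?_)
      · show s - h n ≤ ((⌈s / h n⌉₊ - 1 : ℕ) : ℝ) * h n
        rw [hceil]
        have h1 := Nat.le_ceil (s / h n)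
        rw [div_le_iff₀ (hpos n)] at h1
        linarith
      · show ((⌈s / h n⌉₊ - 1 : ℕ) : ℝ) * h n ≤ s
        rw [hceil, ← le_div_iff₀ (hpos n)]
        linarith [Nat.ceil_lt_add_one (div_pos hs.1 (hpos n)).le]
  rw [ha]
  have h1 := mul_le_mul_of_nonneg_left hfinal (show (0 : EReal) ≤ (lam : EReal) by exact_mod_cast hlam.le)
  refine le_trans (le_of_eq ?_) (add_le_add h1 le_rfl)
  rw [← EReal.coe_sub, ← EReal.coe_mul, ← EReal.coe_add, hb]
  congr 1
  field_simp
  ring
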